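/- arXiv:math/0511406 — 2 statements merged into one kernel-verified Lean document; each statement's English description precedes it below -/
import Mathlib

section
/- For every τ ∈ [0,1], the slice 𝖪 ∩ {(x,y,z) ∈ ℝ³ : x + y + z = τ} equals the convex hull in ℝ³ of the set ∂_∞𝖪 ∩ {(x,y,z) ∈ ℝ³ : x + y + z = τ}. In particular, 𝖪 is the convex hull of ∂_∞𝖪. -/
/-- The solid `𝖪` of admissible index triples `(1/u, 1/v, 1/q)`:
`0 ≤ x ≤ 1/2`, `0 ≤ y ≤ 1/2`, `0 ≤ z`, `x + y + z ≤ 1`. -/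
def solidK : Set (ℝ × ℝ × ℝ) :=
  {p | 0 ≤ p.1 ∧ p.1 ≤ 1 / 2 ∧ 0 ≤ p.2.1 ∧ p.2.1 ≤ 1 / 2 ∧ 0 ≤ p.2.2 ∧
    p.1 + p.2.1 + p.2.2 ≤ 1}

/-- `∂_∞𝖪`: the intersection of `𝖪` with the union of the coordinate planes. -/
def boundaryInftyK : Set (ℝ × ℝ × ℝ) :=
  {p ∈ solidK | p.1 = 0 ∨ p.2.1 = 0 ∨ p.2.2 = 0}

theorem segX {C : Set (ℝ × ℝ × ℝ)} (hC : Convex ℝ C) {x y z m : ℝ} (hx : 0 ≤ x) (hm : x ≤ m)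
    (h0 : ((0, y, z + x) : ℝ × ℝ × ℝ) ∈ C) (h1 : ((m, y, z + x - m) : ℝ × ℝ × ℝ) ∈ C) :
    ((x, y, z) : ℝ × ℝ × ℝ) ∈ C := by
  rcases hx.eq_or_lt with rfl | hx
  · simpa using h0
  have hm0 : 0 < m := by linarith
  have := hC h0 h1 (a := 1 - x / m) (b := x / m)
    (by rw [sub_nonneg, div_le_one hm0]; exact hm) (by positivity) (by ring)
  convert this using 1
  simp only [Prod.smul_mk, Prod.mk_add_mk, smul_eq_mul, Prod.mk.injEq]
  refine ⟨?_, ?_, ?_⟩ <;> field_simp <;> ring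

theorem segY {C : Set (ℝ × ℝ × ℝ)} (hC : Convex ℝ C) {x y z m : ℝ} (hy : 0 ≤ y) (hm : y ≤ m)
    (h0 : ((x, 0, z + y) : ℝ × ℝ × ℝ) ∈ C) (h1 : ((x, m, z + y - m) : ℝ × ℝ × ℝ) ∈ C) :
    ((x, y, z) : ℝ × ℝ × ℝ) ∈ C := by
  rcases hy.eq_or_lt with rfl | hy
  · simpa using h0
  have hm0 : 0 < m := by linarith
  have := hC h0 h1 (a := 1 - y / m) (b := y / m)
    (by rw [sub_nonneg, div_le_one hm0]; exact hm) (by positivity) (by ring)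
  convert this using 1
  simp only [Prod.smul_mk, Prod.mk_add_mk, smul_eq_mul, Prod.mk.injEq]
  refine ⟨?_, ?_, ?_⟩ <;> field_simp <;> ring

theorem slice_sub (τ : ℝ) :
    solidK ∩ {p : ℝ × ℝ × ℝ | p.1 + p.2.1 + p.2.2 = τ} ⊆
      convexHull ℝ (boundaryInftyK ∩ {p : ℝ × ℝ × ℝ | p.1 + p.2.1 + p.2.2 = τ}) := by
  rintro ⟨x, y, z⟩ ⟨⟨hx, hx2, hy, hy2, hz, hs⟩, ht⟩
  simp only [Set.mem_setOf_eq] at hx hx2 hy hy2 hz hs ht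
  have hC := convex_convexHull ℝ
    (boundaryInftyK ∩ {p : ℝ × ℝ × ℝ | p.1 + p.2.1 + p.2.2 = τ})
  have key : ∀ a b c : ℝ, 0 ≤ a → a ≤ 1 / 2 → 0 ≤ b → b ≤ 1 / 2 → 0 ≤ c → a + b + c ≤ 1 →
      (a = 0 ∨ b = 0 ∨ c = 0) → a + b + c = τ → ((a, b, c) : ℝ × ℝ × ℝ) ∈ convexHull ℝ
        (boundaryInftyK ∩ {p : ℝ × ℝ × ℝ | p.1 + p.2.1 + p.2.2 = τ}) :=
    fun a b c h1 h2 h3 h4 h5 h6 h7 h8 =>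
      subset_convexHull ℝ _ ⟨⟨⟨h1, h2, h3, h4, h5, h6⟩, h7⟩, h8⟩
  have h0 := key 0 y (z + x) le_rfl (by norm_num) hy hy2 (by linarith) (by linarith)
    (Or.inl rfl) (by linarith)
  rcases le_total (x + z) (1 / 2) with h | h
  · exact segX hC (m := x + z) hx (by linarith) h0
      (key _ _ _ (by linarith) h hy hy2 (by linarith) (by linarith)
        (Or.inr (Or.inr (by ring))) (by linarith))
  · refine segX hC (m := 1 / 2) hx hx2 h0 ?_
    refine segY hC (m := y + (z + x - 1 / 2)) hy (by linarith) ?_ ?_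
    · exact key _ _ _ (by norm_num) le_rfl le_rfl (by norm_num) (by linarith) (by linarith)
        (Or.inr (Or.inl rfl)) (by linarith)
    · exact key _ _ _ (by norm_num) le_rfl (by linarith) (by linarith) (by linarith)
        (by linarith) (Or.inr (Or.inr (by ring))) (by linarith)

theorem convex_solidK : Convex ℝ solidK := by
  rintro ⟨x, y, z⟩ ⟨h1, h2, h3, h4, h5, h6⟩ ⟨x', y', z'⟩ ⟨k1, k2, k3, k4, k5, k6⟩ a b ha hb hab
  simp only at h1 h2 h3 h4 h5 h6 k1 k2 k3 k4 k5 k6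
  obtain rfl : b = 1 - a := by linarith
  simp only [solidK, Prod.smul_mk, Prod.mk_add_mk, smul_eq_mul, Set.mem_setOf_eq]
  refine ⟨by positivity, ?_, by positivity, ?_, by positivity, ?_⟩ <;> nlinarith

theorem convex_plane (τ : ℝ) : Convex ℝ {p : ℝ × ℝ × ℝ | p.1 + p.2.1 + p.2.2 = τ} := by
  rintro ⟨x, y, z⟩ h ⟨x', y', z'⟩ k a b ha hb hab
  simp only [Prod.smul_mk, Prod.mk_add_mk, smul_eq_mul, Set.mem_setOf_eq] at h k ⊢
  linear_combination a * h + b * k + τ * hab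

/-- For every `τ ∈ [0,1]`, the slice of `𝖪` by the plane `x + y + z = τ` is the convex hull of
the corresponding slice of `∂_∞𝖪`; in particular `𝖪` is the convex hull of `∂_∞𝖪`. -/
theorem stmt_7 :
    (∀ τ ∈ Set.Icc (0 : ℝ) 1,
      solidK ∩ {p : ℝ × ℝ × ℝ | p.1 + p.2.1 + p.2.2 = τ} =
        convexHull ℝ (boundaryInftyK ∩ {p : ℝ × ℝ × ℝ | p.1 + p.2.1 + p.2.2 = τ})) ∧
    solidK = convexHull ℝ boundaryInftyK := by
  refine ⟨fun τ _ => (slice_sub τ).antisymm ?_, Set.Subset.antisymm ?_ ?_⟩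
  · exact convexHull_min (Set.inter_subset_inter_left _ fun p hp => hp.1)
      (convex_solidK.inter (convex_plane τ))
  · intro p hp
    exact convexHull_mono Set.inter_subset_left (slice_sub _ ⟨hp, rfl⟩)
  · exact convexHull_min (fun p hp => hp.1) convex_solidK
end

section
/- Cone separation lemma: let X be a compact Hausdorff space and let 𝒞 ⊆ C(X, ℝ) be a convex cone of continuous real-valued functions (closed under addition and under multiplication by nonnegative real scalars) such that sup_{x ∈ X} f(x) ≥ 0 for every f ∈ 𝒞. Then there exists a regular Borel probability measure μ on X such that ∫_X f dμ ≥ 0 for every f ∈ 𝒞. -/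
open MeasureTheory

/-- Cone separation lemma: if `𝒞` is a convex cone of continuous real functions on a (nonempty)
compact Hausdorff space `X` such that `sup_{x ∈ X} f(x) ≥ 0` for every `f ∈ 𝒞`, then there is a
regular Borel probability measure `μ` on `X` with `∫ f dμ ≥ 0` for every `f ∈ 𝒞`. -/
theorem stmt_9 (X : Type*) [TopologicalSpace X] [CompactSpace X] [T2Space X] [Nonempty X]
    [MeasurableSpace X] [BorelSpace X]
    (𝒞 : Set C(X, ℝ))
    (hadd : ∀ f ∈ 𝒞, ∀ g ∈ 𝒞, f + g ∈ 𝒞)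
    (hsmul : ∀ f ∈ 𝒞, ∀ t : ℝ, 0 ≤ t → t • f ∈ 𝒞)
    (hsup : ∀ f ∈ 𝒞, 0 ≤ ⨆ x, f x) :
    ∃ μ : Measure X, IsProbabilityMeasure μ ∧ μ.Regular ∧
      ∀ f ∈ 𝒞, 0 ≤ ∫ x, f x ∂μ := by
  let s : PointedCone ℝ C(X, ℝ) :=
    { carrier := {h | ∃ f : C(X, ℝ), (f = 0 ∨ f ∈ 𝒞) ∧ ∀ x, f x ≤ h x}
      zero_mem' := ⟨0, Or.inl rfl, fun x => le_rfl⟩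
      add_mem' := by
        rintro a b ⟨f, hf, hfa⟩ ⟨g, hg, hgb⟩
        refine ⟨f + g, ?_, fun x => add_le_add (hfa x) (hgb x)⟩
        rcases hf with rfl | hf
        · simpa using hg
        · rcases hg with rfl | hg
          · simpa using Or.inr hf
          · exact Or.inr (hadd f hf g hg)
      smul_mem' := by
        rintro ⟨c, hc⟩ a ⟨f, hf, hfa⟩
        refine ⟨c • f, ?_, fun x => mul_le_mul_of_nonneg_left (hfa x) hc⟩
        rcases hf with rfl | hf
        · simp
        · exact Or.inr (hsmul f hf c hc) }
  have hs : ∀ h : C(X, ℝ), h ∈ s ↔ ∃ f : C(X, ℝ), (f = 0 ∨ f ∈ 𝒞) ∧ ∀ x, f x ≤ h x :=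
    fun h => Iff.rfl
  have h1 : (1 : C(X, ℝ)) ≠ 0 := one_ne_zero
  obtain ⟨g, hg1, hgs⟩ := riesz_extension s (LinearPMap.mkSpanSingleton (1 : C(X, ℝ)) (1 : ℝ) h1)
    (by
      rintro ⟨x, hx⟩ hxs
      obtain ⟨c, rfl⟩ := Submodule.mem_span_singleton.1 hx
      rw [LinearPMap.mkSpanSingleton'_apply]
      obtain ⟨f, hf, hfx⟩ := (hs _).1 hxs
      have hfc : ∀ x, f x ≤ c := fun x => by simpa using hfx x
      have : 0 ≤ c := by
        rcases hf with rfl | hf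
        · simpa using hfc (Classical.arbitrary X)
        · exact (hsup f hf).trans (ciSup_le hfc)
      simpa using this)
    (by
      intro y
      refine ⟨⟨‖y‖ • 1, Submodule.mem_span_singleton.2 ⟨_, rfl⟩⟩, ?_⟩
      refine (hs _).2 ⟨0, Or.inl rfl, fun x => ?_⟩
      have := neg_le_of_abs_le (y.norm_coe_le_norm x)
      simp
      linarith)
  have hg1' : g 1 = 1 := by
    have := hg1 ⟨(1 : C(X, ℝ)), Submodule.mem_span_singleton_self _⟩
    rw [this]
    exact LinearPMap.mkSpanSingleton_apply ℝ ℝ h1 (1 : ℝ)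
  let Λ : CompactlySupportedContinuousMap X ℝ →ₚ[ℝ] ℝ := PositiveLinearMap.mk₀
    { toFun := fun f => g f.toContinuousMap
      map_add' := fun a b => g.map_add a.toContinuousMap b.toContinuousMap
      map_smul' := fun c a => g.map_smul c a.toContinuousMap }
    (fun f hf => hgs _ ((hs _).2 ⟨0, Or.inl rfl, fun x => hf x⟩))
  have key : ∀ f : C(X, ℝ), ∫ x, f x ∂(RealRMK.rieszMeasure Λ) = g f := fun f =>
    RealRMK.integral_rieszMeasure Λ ⟨f, HasCompactSupport.of_compactSpace _⟩
  refine ⟨RealRMK.rieszMeasure Λ, ⟨?_⟩, inferInstance, fun f hf => ?_⟩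
  · have := key 1
    rw [hg1'] at this
    simp [Measure.real] at this
    exact (ENNReal.toReal_eq_one_iff _).1 this
  · rw [key]
    exact hgs _ ((hs _).2 ⟨f, Or.inr hf, fun x => le_rfl⟩)
end
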